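/- Let 1 ≤ p < ∞, let 0 = x_0 < x_1 < ⋯ < x_N = 1 be a partition of [0,1], let X_1,…,X_N be half-open subintervals of [0,1], and let u_i : X_i → [x_{i-1}, x_i) be affine bijections (for i = N, u_N extended so as to map onto [x_{N-1}, x_N]), with |u_i'| = a_i. Let λ_i ∈ L^p(X_i) and S_i ∈ L^∞(X_i), and define Φ on L^p[0,1] by Φg := Σ_{i=1}^N (λ_i ∘ u_i^{-1})·χ_{u_i(X_i)} + Σ_{i=1}^N (S_i ∘ u_i^{-1})·(g|_{X_i} ∘ u_i^{-1})·χ_{u_i(X_i)}. Then Φ maps L^p[0,1] into itself, and for all g,h ∈ L^p[0,1], ‖Φg − Φh‖_{L^p[0,1]} ≤ ( Σ_{i=1}^N a_i ‖S_i‖_{L^∞(X_i)}^p )^{1/p} · ‖g − h‖_{L^p[0,1]}. In particular, if ( Σ_{i=1}^N a_i ‖S_i‖_{L^∞(X_i)}^p )^{1/p} < 1, then Φ is a contraction on L^p[0,1] and has a unique fixed point 𝔣 ∈ L^p[0,1]. -/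

import Mathlib

open MeasureTheory Set
open scoped ENNReal

/-- A self-map of the `L^p` functions with Lipschitz constant `C < 1` has an a.e. unique fixed
point. -/
theorem exists_ae_unique_fixedPoint_of_eLpNorm_sub_le {α F : Type*} [MeasurableSpace α]
    [NormedAddCommGroup F] [CompleteSpace F] {μ : Measure α} {q : ℝ≥0∞} (hq : 1 ≤ q)
    {Φ : (α → F) → α → F} {C : ℝ≥0∞}
    (hmem : ∀ g, MemLp g q μ → MemLp (Φ g) q μ)
    (hlip : ∀ g h, MemLp g q μ → MemLp h q μ →
      eLpNorm (fun x => Φ g x - Φ h x) q μ ≤ C * eLpNorm (fun x => g x - h x) q μ)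
    (hC : C < 1) :
    ∃ f, MemLp f q μ ∧ Φ f =ᵐ[μ] f ∧ ∀ g, MemLp g q μ → Φ g =ᵐ[μ] g → g =ᵐ[μ] f := by
  have : Fact (1 ≤ q) := ⟨hq⟩
  have hCtop : C ≠ ⊤ := hC.ne_top
  let Ψ : Lp F q μ → Lp F q μ := fun f => (hmem f (Lp.memLp f)).toLp _
  have hΨ : ContractingWith C.toNNReal Ψ := by
    refine ⟨?_, fun f g => ?_⟩
    · rw [← ENNReal.coe_lt_coe, ENNReal.coe_toNNReal hCtop]
      exact hC
    · rw [Lp.edist_toLp_toLp, Lp.edist_def, ENNReal.coe_toNNReal hCtop]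
      exact hlip f g (Lp.memLp f) (Lp.memLp g)
  let f := ContractingWith.fixedPoint Ψ hΨ
  have hf : Ψ f = f := hΨ.fixedPoint_isFixedPt
  have hΦf : Φ f =ᵐ[μ] f := by
    have h := (hmem f (Lp.memLp f)).coeFn_toLp
    change (Ψ f : α → F) =ᵐ[μ] _ at h
    rw [hf] at h
    exact h.symm
  refine ⟨f, Lp.memLp f, hΦf, fun g hg hΦg => ?_⟩
  have hgf : MemLp (fun x => g x - f x) q μ := hg.sub (Lp.memLp f)
  have hle : eLpNorm (fun x => g x - f x) q μ ≤ C * eLpNorm (fun x => g x - f x) q μ := by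
    have hcongr : (fun x => g x - f x) =ᵐ[μ] fun x => Φ g x - Φ f x := by
      filter_upwards [hΦf, hΦg] with x h₁ h₂
      rw [h₁, h₂]
    exact (eLpNorm_congr_ae hcongr).trans_le (hlip g f hg (Lp.memLp f))
  have hzero : eLpNorm (fun x => g x - f x) q μ = 0 := by
    by_contra hne
    have hlt := ENNReal.mul_lt_mul_left hne hgf.eLpNorm_ne_top hC
    rw [one_mul] at hlt
    exact absurd hle hlt.not_ge
  rw [eLpNorm_eq_zero_iff hgf.1 (zero_lt_one.trans_le hq).ne'] at hzero
  filter_upwards [hzero] with x hx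
  exact sub_eq_zero.mp hx

theorem measurableEmbedding_sub_div {c : ℝ} (hc : c ≠ 0) (d : ℝ) :
    MeasurableEmbedding fun z : ℝ => (z - d) / c := by
  have h := (measurableEmbedding_mulLeft₀ (inv_ne_zero hc)).comp (measurableEmbedding_subRight d)
  convert h using 2 with z
  simp [div_eq_inv_mul]

/-- The push-forward of Lebesgue measure on the image of `X` under `x ↦ c * x + d`, by the inverse
affine map. -/
theorem map_sub_div_restrict_image {c : ℝ} (hc : c ≠ 0) (d : ℝ) (X : Set ℝ) :
    Measure.map (fun z : ℝ => (z - d) / c)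
      (volume.restrict ((fun x => c * x + d) '' X)) =
      ENNReal.ofReal |c| • volume.restrict X := by
  have hpre : (fun x => c * x + d) '' X = (fun z : ℝ => (z - d) / c) ⁻¹' X := by
    refine congrFun (image_eq_preimage_of_inverse ?_ ?_) X
    · intro x
      field_simp
      ring
    · intro x
      field_simp
      ring
  have hmap : Measure.map (fun z : ℝ => (z - d) / c) volume = ENNReal.ofReal |c| • volume := by
    have hcomp : (fun z : ℝ => (z - d) / c) = (fun z => c⁻¹ * z) ∘ fun z => z - d := by
      ext z
      simp [div_eq_inv_mul]
    rw [hcomp, ← Measure.map_map (by fun_prop) (by fun_prop), map_sub_right_eq_self,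
      Real.map_volume_mul_left (inv_ne_zero hc), inv_inv]
  rw [hpre, ← (measurableEmbedding_sub_div hc d).restrict_map, hmap, Measure.restrict_smul]

/-- A point of `[t 0, t k)` lies in one of the half-open pieces of the partition `t`. -/
theorem exists_mem_Ico_castSucc_succ {N : ℕ} (t : Fin (N + 1) → ℝ) {z : ℝ} (hz : t 0 ≤ z)
    (k : Fin (N + 1)) (hk : z < t k) : ∃ i : Fin N, z ∈ Ico (t i.castSucc) (t i.succ) := by
  induction k using Fin.induction with
  | zero => exact absurd hk hz.not_gt
  | succ i ih =>
    rcases lt_or_ge z (t i.castSucc) with h | h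
    · exact ih h
    · exact ⟨i, h, hk⟩

/-- The `p`-th power integral of a product is bounded using the essential supremum of one factor. -/
theorem lintegral_enorm_mul_rpow_le {α : Type*} [MeasurableSpace α] {μ : Measure α} {p : ℝ}
    (hp : 0 ≤ p) {s : α → ℝ} (hs : MemLp s ⊤ μ) (f : α → ℝ) :
    ∫⁻ x, ‖s x * f x‖ₑ ^ p ∂μ ≤ eLpNorm s ⊤ μ ^ p * ∫⁻ x, ‖f x‖ₑ ^ p ∂μ := by
  rw [← lintegral_const_mul' _ _ (ENNReal.rpow_ne_top_of_nonneg hp hs.eLpNorm_ne_top)]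
  refine lintegral_mono_ae ?_
  have hbound := ae_le_eLpNormEssSup (f := s) (μ := μ)
  filter_upwards [hbound] with x hx
  rw [enorm_mul, ENNReal.mul_rpow_of_nonneg _ _ hp, eLpNorm_exponent_top]
  gcongr

/-- The affine Read–Bajraktarević operator on `L^p[0,1]`, `1 ≤ p < ∞`, built from affine
maps `uᵢ(x) = cᵢx + dᵢ` taking half-open intervals `Xᵢ = [pᵢ,qᵢ)` onto the pieces of a
partition `0 = t₀ < ⋯ < t_N = 1` (the last piece closed), with `λᵢ ∈ L^p(Xᵢ)` and
`Sᵢ ∈ L^∞(Xᵢ)`, maps `L^p[0,1]` into itself with Lipschitz constant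
`C = (∑ᵢ aᵢ ‖Sᵢ‖_∞^p)^{1/p}` (where `aᵢ = |cᵢ|`); if `C < 1` it is a contraction
with a unique fixed point in `L^p[0,1]`. -/
theorem stmt11 (N : ℕ) (hN : 0 < N) (p : ℝ) (hp : 1 ≤ p)
    (t : Fin (N + 1) → ℝ) (ht0 : t 0 = 0) (htN : t (Fin.last N) = 1) (htm : StrictMono t)
    (pa qa : Fin N → ℝ) (hpq : ∀ i, pa i < qa i)
    (hsub : ∀ i, Ico (pa i) (qa i) ⊆ Icc (0 : ℝ) 1)
    (c d : Fin N → ℝ) (hc : ∀ i, c i ≠ 0)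
    (him : ∀ i, (fun x => c i * x + d i) '' Ico (pa i) (qa i) =
      Ico (t i.castSucc) (t i.succ))
    (E : Fin N → Set ℝ)
    (hE : ∀ i, E i = if (i : ℕ) + 1 < N then Ico (t i.castSucc) (t i.succ)
      else Icc (t i.castSucc) (t i.succ))
    (lam S : Fin N → ℝ → ℝ)
    (hlam : ∀ i, MemLp (lam i) (ENNReal.ofReal p) (volume.restrict (Ico (pa i) (qa i))))
    (hS : ∀ i, MemLp (S i) ⊤ (volume.restrict (Ico (pa i) (qa i))))
    (Φ : (ℝ → ℝ) → (ℝ → ℝ))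
    (hΦ : ∀ g x, Φ g x = ∑ i, Set.indicator (E i)
      (fun z => lam i ((z - d i) / c i) + S i ((z - d i) / c i) * g ((z - d i) / c i)) x)
    (C : ℝ≥0∞)
    (hC : C = (∑ i, ENNReal.ofReal |c i| *
      (eLpNorm (S i) ⊤ (volume.restrict (Ico (pa i) (qa i)))) ^ p) ^ (1 / p)) :
    (∀ g, MemLp g (ENNReal.ofReal p) (volume.restrict (Icc (0 : ℝ) 1)) →
      MemLp (Φ g) (ENNReal.ofReal p) (volume.restrict (Icc (0 : ℝ) 1))) ∧
    (∀ g h, MemLp g (ENNReal.ofReal p) (volume.restrict (Icc (0 : ℝ) 1)) →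
      MemLp h (ENNReal.ofReal p) (volume.restrict (Icc (0 : ℝ) 1)) →
      eLpNorm (fun x => Φ g x - Φ h x) (ENNReal.ofReal p) (volume.restrict (Icc (0 : ℝ) 1)) ≤
        C * eLpNorm (fun x => g x - h x) (ENNReal.ofReal p) (volume.restrict (Icc (0 : ℝ) 1))) ∧
    (C < 1 →
      ∃ f, MemLp f (ENNReal.ofReal p) (volume.restrict (Icc (0 : ℝ) 1)) ∧
        Φ f =ᵐ[volume.restrict (Icc (0 : ℝ) 1)] f ∧
        ∀ g, MemLp g (ENNReal.ofReal p) (volume.restrict (Icc (0 : ℝ) 1)) →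
          Φ g =ᵐ[volume.restrict (Icc (0 : ℝ) 1)] g →
          g =ᵐ[volume.restrict (Icc (0 : ℝ) 1)] f) := by
  have hp0 : 0 < p := one_pos.trans_le hp
  have hP1 : 1 ≤ ENNReal.ofReal p := by simpa using ENNReal.ofReal_le_ofReal hp
  have hEIcc : ∀ i, E i ⊆ Icc (t i.castSucc) (t i.succ) := by
    intro i
    rw [hE]
    split_ifs
    · exact Ico_subset_Icc_self
    · exact subset_rfl
  have hIcoE : ∀ i, Ico (t i.castSucc) (t i.succ) ⊆ E i := by
    intro i
    rw [hE]
    split_ifs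
    · exact subset_rfl
    · exact Ico_subset_Icc_self
  have hEmeas : ∀ i, MeasurableSet (E i) := by
    intro i
    rw [hE]
    split_ifs
    · exact measurableSet_Ico
    · exact measurableSet_Icc
  have hEae : ∀ i, E i =ᵐ[volume] Ico (t i.castSucc) (t i.succ) := fun i =>
    ((hEIcc i).eventuallyLE.trans Ico_ae_eq_Icc.symm.le).antisymm (hIcoE i).eventuallyLE
  have hmap : ∀ i, Measure.map (fun z : ℝ => (z - d i) / c i)
      (volume.restrict (Ico (t i.castSucc) (t i.succ))) =
      ENNReal.ofReal |c i| • volume.restrict (Ico (pa i) (qa i)) := fun i => by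
    rw [← him i]
    exact map_sub_div_restrict_image (hc i) (d i) _
  have hpiece : ∀ g i z, z ∈ Ico (t i.castSucc) (t i.succ) → Φ g z =
      lam i ((z - d i) / c i) + S i ((z - d i) / c i) * g ((z - d i) / c i) := by
    intro g i z hz
    rw [hΦ, Finset.sum_eq_single i, indicator_of_mem (hIcoE i hz)]
    · intro j _ hj
      refine indicator_of_notMem (fun hzj => ?_) _
      rcases lt_or_gt_of_ne hj with hlt | hgt
      · rw [hE, if_pos (by omega)] at hzj
        have : t j.succ ≤ t i.castSucc := htm.monotone (Fin.succ_le_castSucc_iff.mpr hlt)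
        exact absurd (hzj.2.trans_le this) hz.1.not_gt
      · have : t i.succ ≤ t j.castSucc := htm.monotone (Fin.succ_le_castSucc_iff.mpr hgt)
        exact absurd (hz.2.trans_le this) (hEIcc j hzj).1.not_gt
    · simp
  have hmem : ∀ g, MemLp g (ENNReal.ofReal p) (volume.restrict (Icc (0 : ℝ) 1)) →
      MemLp (Φ g) (ENNReal.ofReal p) (volume.restrict (Icc (0 : ℝ) 1)) := by
    intro g hg
    have hΦg : Φ g = fun x => ∑ i, Set.indicator (E i)
      (fun z => lam i ((z - d i) / c i) + S i ((z - d i) / c i) * g ((z - d i) / c i)) x :=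
      funext (hΦ g)
    rw [hΦg]
    refine memLp_finsetSum _ fun i _ => ?_
    have hX : MemLp (fun x => lam i x + S i x * g x) (ENNReal.ofReal p)
        (volume.restrict (Ico (pa i) (qa i))) :=
      (hlam i).add ((hg.mono_measure (Measure.restrict_mono_set _ (hsub i))).mul (hS i))
    have hJ : MemLp ((fun x => lam i x + S i x * g x) ∘ fun z : ℝ => (z - d i) / c i)
        (ENNReal.ofReal p) (volume.restrict (Ico (t i.castSucc) (t i.succ))) := by
      rw [← (measurableEmbedding_sub_div (hc i) (d i)).memLp_map_measure_iff, hmap]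
      exact hX.smul_measure ENNReal.ofReal_ne_top
    refine MemLp.mono_measure Measure.restrict_le_self ?_
    rw [memLp_indicator_iff_restrict (hEmeas i), Measure.restrict_congr_set (hEae i)]
    exact hJ
  have hlip : ∀ g h, MemLp g (ENNReal.ofReal p) (volume.restrict (Icc (0 : ℝ) 1)) →
      MemLp h (ENNReal.ofReal p) (volume.restrict (Icc (0 : ℝ) 1)) →
      eLpNorm (fun x => Φ g x - Φ h x) (ENNReal.ofReal p) (volume.restrict (Icc (0 : ℝ) 1)) ≤
        C * eLpNorm (fun x => g x - h x) (ENNReal.ofReal p)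
          (volume.restrict (Icc (0 : ℝ) 1)) := by
    intro g h _ _
    have hcover : Ico (0 : ℝ) 1 ⊆ ⋃ i : Fin N, Ico (t i.castSucc) (t i.succ) := fun z hz =>
      mem_iUnion.mpr (exists_mem_Ico_castSucc_succ t (ht0.trans_le hz.1) (Fin.last N)
        (hz.2.trans_eq htN.symm))
    have hsum : ∫⁻ x in Icc (0 : ℝ) 1, ‖Φ g x - Φ h x‖ₑ ^ p ≤
        (∑ i, ENNReal.ofReal |c i| *
          (eLpNorm (S i) ⊤ (volume.restrict (Ico (pa i) (qa i)))) ^ p) *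
          ∫⁻ x in Icc (0 : ℝ) 1, ‖g x - h x‖ₑ ^ p := by
      calc ∫⁻ x in Icc (0 : ℝ) 1, ‖Φ g x - Φ h x‖ₑ ^ p
          = ∫⁻ x in Ico (0 : ℝ) 1, ‖Φ g x - Φ h x‖ₑ ^ p := by
            rw [Measure.restrict_congr_set Ico_ae_eq_Icc]
        _ ≤ ∫⁻ x in ⋃ i : Fin N, Ico (t i.castSucc) (t i.succ), ‖Φ g x - Φ h x‖ₑ ^ p :=
            lintegral_mono_set hcover
        _ ≤ ∑ i : Fin N, ∫⁻ x in Ico (t i.castSucc) (t i.succ), ‖Φ g x - Φ h x‖ₑ ^ p := by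
            rw [← tsum_fintype (L := SummationFilter.unconditional _)]
            exact lintegral_iUnion_le _ _
        _ ≤ _ := by
            rw [Finset.sum_mul]
            refine Finset.sum_le_sum fun i _ => ?_
            calc ∫⁻ x in Ico (t i.castSucc) (t i.succ), ‖Φ g x - Φ h x‖ₑ ^ p
                = ∫⁻ z in Ico (t i.castSucc) (t i.succ),
                    ‖S i ((z - d i) / c i) *
                      (g ((z - d i) / c i) - h ((z - d i) / c i))‖ₑ ^ p := by
                  refine setLIntegral_congr_fun measurableSet_Ico fun z hz => ?_
                  simp only [hpiece _ i z hz]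
                  congr 2
                  ring
              _ = ENNReal.ofReal |c i| *
                    ∫⁻ x in Ico (pa i) (qa i), ‖S i x * (g x - h x)‖ₑ ^ p := by
                  rw [← smul_eq_mul, ← lintegral_smul_measure, ← hmap,
                    (measurableEmbedding_sub_div (hc i) (d i)).lintegral_map]
              _ ≤ _ := by
                  rw [mul_assoc]
                  gcongr
                  refine (lintegral_enorm_mul_rpow_le hp0.le (hS i) _).trans ?_
                  gcongr
                  exact hsub i
    have hP0 : ENNReal.ofReal p ≠ 0 := (zero_lt_one.trans_le hP1).ne'
    rw [eLpNorm_eq_lintegral_rpow_enorm_toReal hP0 ENNReal.ofReal_ne_top,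
      eLpNorm_eq_lintegral_rpow_enorm_toReal hP0 ENNReal.ofReal_ne_top,
      ENNReal.toReal_ofReal hp0.le, hC, ← ENNReal.mul_rpow_of_nonneg _ _ (by positivity)]
    exact ENNReal.rpow_le_rpow hsum (by positivity)
  exact ⟨hmem, hlip, exists_ae_unique_fixedPoint_of_eLpNorm_sub_le hP1 hmem hlip⟩
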